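/- Let P be an N×N upper triangular matrix over 𝔽₂ with all diagonal entries equal to 1 and let A ⊆ {0,…,N−1}. Then C_{P·G_N}(A)^⊥ = C_{(P^t)^{−1}·Q_π·G_N·Q_π}(Aᶜ), where Aᶜ = {0,…,N−1} ∖ A. -/

import Mathlib

open Matrix

/-- The set of positions of nonzero bits (within `{0,…,m−1}`) of the binary expansion of `i`. -/
def bsupp (m i : ℕ) : Finset ℕ := (Finset.range m).filter fun k => i.testBit k

/-- The polar transform matrix `G_N`, `N = 2^m`: entry `(i,j)` is `1` iff `supp j ⊆ supp i`. -/
def GN (m : ℕ) : Matrix (Fin (2^m)) (Fin (2^m)) (ZMod 2) :=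
  fun i j => if bsupp m (j : ℕ) ⊆ bsupp m (i : ℕ) then 1 else 0

/-- The permutation matrix swapping `i` and `N−1−i`. -/
def Qpi (m : ℕ) : Matrix (Fin (2^m)) (Fin (2^m)) (ZMod 2) :=
  fun i j => if (j : ℕ) = 2^m - 1 - (i : ℕ) then 1 else 0

/-- The linear code spanned by the rows of `B` with index in `A`. -/
def code {N : ℕ} (B : Matrix (Fin N) (Fin N) (ZMod 2)) (A : Set (Fin N)) :
    Submodule (ZMod 2) (Fin N → ZMod 2) :=
  Submodule.span (ZMod 2) ((fun i => B i) '' A)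

/-- The dual code of a linear code `C ⊆ 𝔽₂^N`. -/
def dualCode {N : ℕ} (C : Submodule (ZMod 2) (Fin N → ZMod 2)) :
    Submodule (ZMod 2) (Fin N → ZMod 2) where
  carrier := {v | ∀ c ∈ C, ∑ k, v k * c k = 0}
  zero_mem' := by intro c hc; simp
  add_mem' := by
    intro a b ha hb c hc
    have h1 := ha c hc
    have h2 := hb c hc
    simp only [Pi.add_apply, add_mul, Finset.sum_add_distrib, h1, h2, add_zero]
  smul_mem' := by
    intro r v hv c hc
    have h := hv c hc
    simp only [Pi.smul_apply, smul_eq_mul, mul_assoc, ← Finset.mul_sum, h, mul_zero]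

theorem bsupp_subset_iff {m i j : ℕ} :
    bsupp m j ⊆ bsupp m i ↔ ∀ k < m, j.testBit k = true → i.testBit k = true := by
  simp only [bsupp, Finset.subset_iff, Finset.mem_filter, Finset.mem_range]
  exact ⟨fun h k hk hj => (h ⟨hk, hj⟩).2, fun h k hk => ⟨hk.1, h k hk.1 hk.2⟩⟩

theorem bsupp_rev_subset_rev_iff {m : ℕ} (i j : Fin (2 ^ m)) :
    bsupp m (Fin.rev j : ℕ) ⊆ bsupp m (Fin.rev i : ℕ) ↔ bsupp m (i : ℕ) ⊆ bsupp m (j : ℕ) := by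
  simp only [bsupp_subset_iff, Fin.val_rev, Nat.testBit_two_pow_sub_succ i.isLt,
    Nat.testBit_two_pow_sub_succ j.isLt]
  refine forall₂_congr fun k hk => ?_
  cases (i : ℕ).testBit k <;> cases (j : ℕ).testBit k <;> simp [hk]

theorem Qpi_apply {m : ℕ} (i j : Fin (2 ^ m)) : Qpi m i j = if j = Fin.rev i then 1 else 0 := by
  have h : (j : ℕ) = 2 ^ m - 1 - (i : ℕ) ↔ j = Fin.rev i := by
    rw [Fin.ext_iff, Fin.val_rev]
    omega
  simp only [Qpi, h]

theorem Qpi_mul_GN_mul_Qpi (m : ℕ) : Qpi m * GN m * Qpi m = (GN m)ᵀ := by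
  ext i j
  have hrev : ∀ k : Fin (2 ^ m), j = Fin.rev k ↔ k = Fin.rev j := fun k =>
    ⟨fun h => by rw [h, Fin.rev_rev], fun h => by rw [h, Fin.rev_rev]⟩
  simp only [Matrix.mul_apply, Qpi_apply, hrev, ite_mul, mul_ite, one_mul, mul_one, zero_mul,
    mul_zero, Finset.sum_ite_eq', Finset.mem_univ, if_true]
  simp only [GN, bsupp_rev_subset_rev_iff, Matrix.transpose_apply]

/-- Flipping bit `b` permutes the indices below `2 ^ m`. -/
def flipBit {m : ℕ} (b : ℕ) (hb : b < m) (j : Fin (2 ^ m)) : Fin (2 ^ m) :=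
  ⟨(j : ℕ) ^^^ 2 ^ b, Nat.xor_lt_two_pow j.isLt (Nat.pow_lt_pow_right one_lt_two hb)⟩

theorem flipBit_flipBit {m b : ℕ} (hb : b < m) (j : Fin (2 ^ m)) :
    flipBit b hb (flipBit b hb j) = j := by
  simp [flipBit]

theorem flipBit_ne {m b : ℕ} (hb : b < m) (j : Fin (2 ^ m)) : flipBit b hb j ≠ j := by
  intro h
  have := congrArg (fun x : Fin (2 ^ m) => (x : ℕ).testBit b) h
  simp [flipBit, Nat.testBit_xor] at this

theorem testBit_flipBit_of_ne {m b k : ℕ} (hb : b < m) (j : Fin (2 ^ m)) (hk : b ≠ k) :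
    (flipBit b hb j : ℕ).testBit k = (j : ℕ).testBit k := by
  simp [flipBit, Nat.testBit_xor, Nat.testBit_two_pow_of_ne hk]

theorem bsupp_flipBit_subset_iff {m b : ℕ} (hb : b < m) (i j : Fin (2 ^ m))
    (hi : (i : ℕ).testBit b = true) :
    bsupp m (flipBit b hb j : ℕ) ⊆ bsupp m (i : ℕ) ↔ bsupp m (j : ℕ) ⊆ bsupp m (i : ℕ) := by
  simp only [bsupp_subset_iff]
  refine forall₂_congr fun k _ => ?_
  rcases eq_or_ne b k with rfl | hk
  · simp [hi]
  · rw [testBit_flipBit_of_ne hb j hk]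

theorem bsupp_subset_flipBit_iff {m b : ℕ} (hb : b < m) (i j : Fin (2 ^ m))
    (hi : (i : ℕ).testBit b = false) :
    bsupp m (i : ℕ) ⊆ bsupp m (flipBit b hb j : ℕ) ↔ bsupp m (i : ℕ) ⊆ bsupp m (j : ℕ) := by
  simp only [bsupp_subset_iff]
  refine forall₂_congr fun k _ => ?_
  rcases eq_or_ne b k with rfl | hk
  · simp [hi]
  · rw [testBit_flipBit_of_ne hb j hk]

theorem bsupp_injective {m : ℕ} : Function.Injective fun i : Fin (2 ^ m) => bsupp m (i : ℕ) := by
  intro i j h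
  have h₁ := bsupp_subset_iff.1 (Finset.Subset.antisymm_iff.1 h).1
  have h₂ := bsupp_subset_iff.1 (Finset.Subset.antisymm_iff.1 h).2
  refine Fin.ext (Nat.eq_of_testBit_eq fun k => ?_)
  rcases lt_or_ge k m with hk | hk
  · exact Bool.eq_iff_iff.2 ⟨h₁ k hk, h₂ k hk⟩
  · have hpow : 2 ^ m ≤ 2 ^ k := Nat.pow_le_pow_right two_pos hk
    rw [Nat.testBit_lt_two_pow (i.isLt.trans_le hpow),
      Nat.testBit_lt_two_pow (j.isLt.trans_le hpow)]

theorem GN_mul_self (m : ℕ) : GN m * GN m = 1 := by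
  ext i k
  rw [Matrix.mul_apply]
  by_cases hki : bsupp m (k : ℕ) ⊆ bsupp m (i : ℕ)
  · rcases eq_or_ne i k with rfl | hne
    · rw [Finset.sum_eq_single i, Matrix.one_apply_eq]
      · simp [GN]
      · intro j _ hj
        simp only [GN, mul_ite, mul_one, mul_zero]
        split_ifs with h₁ h₂
        · exact absurd (bsupp_injective (Finset.Subset.antisymm h₂ h₁)) hj
        all_goals rfl
      · simp
    · rw [Matrix.one_apply_ne hne]
      have hik : ¬ bsupp m (i : ℕ) ⊆ bsupp m (k : ℕ) := fun h =>
        hne (bsupp_injective (Finset.Subset.antisymm h hki))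
      rw [bsupp_subset_iff] at hik
      push Not at hik
      obtain ⟨b, hb, hi, hk⟩ := hik
      replace hk := Bool.eq_false_iff.2 hk
      refine Finset.sum_involution (fun j _ => flipBit b hb j) (fun j _ => ?_)
        (fun j _ _ => flipBit_ne hb j) (fun j _ => Finset.mem_univ _)
        (fun j _ => flipBit_flipBit hb j)
      simp only [GN, bsupp_flipBit_subset_iff hb i j hi, bsupp_subset_flipBit_iff hb k j hk]
      exact CharTwo.add_self_eq_zero _
  · have hne : i ≠ k := by
      rintro rfl
      exact hki (Finset.Subset.refl _)
    rw [Matrix.one_apply_ne hne]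
    refine Finset.sum_eq_zero fun j _ => ?_
    simp only [GN, mul_ite, mul_one, mul_zero]
    split_ifs with h₁ h₂
    · exact absurd (h₁.trans h₂) hki
    all_goals rfl

theorem mem_dualCode_code_iff {N : ℕ} (B : Matrix (Fin N) (Fin N) (ZMod 2)) (A : Set (Fin N))
    (v : Fin N → ZMod 2) : v ∈ dualCode (code B A) ↔ ∀ i ∈ A, (B *ᵥ v) i = 0 := by
  have hdot : ∀ i, (B *ᵥ v) i = ∑ k, v k * B i k := fun i => by
    simp only [Matrix.mulVec, dotProduct, mul_comm]
  constructor
  · intro hv i hi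
    rw [hdot]
    exact hv _ (Submodule.subset_span ⟨i, hi, rfl⟩)
  · intro hv c hc
    induction hc using Submodule.span_induction with
    | mem c hc =>
      obtain ⟨i, hi, rfl⟩ := hc
      exact (hdot i).symm.trans (hv i hi)
    | zero => simp
    | add a b _ _ ha hb => simp [mul_add, Finset.sum_add_distrib, ha, hb]
    | smul r a _ ha => simp [mul_left_comm _ r, ← Finset.mul_sum, ha]

theorem dualCode_code_of_mul_transpose_eq_one {N : ℕ} {B D : Matrix (Fin N) (Fin N) (ZMod 2)}
    (h : B * Dᵀ = 1) (A : Set (Fin N)) : dualCode (code B A) = code D Aᶜ := by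
  apply le_antisymm
  · intro v hv
    rw [mem_dualCode_code_iff] at hv
    have hexp : v = ∑ i, (B *ᵥ v) i • D i := by
      have h₁ : v = Dᵀ *ᵥ (B *ᵥ v) := by
        rw [Matrix.mulVec_mulVec, mul_eq_one_comm.1 h, Matrix.one_mulVec]
      conv_lhs => rw [h₁]
      ext k
      simp [Matrix.mulVec, dotProduct, mul_comm]
    rw [hexp]
    refine Submodule.sum_mem _ fun i _ => ?_
    by_cases hi : i ∈ A
    · rw [hv i hi, zero_smul]
      exact Submodule.zero_mem _
    · exact Submodule.smul_mem _ _ (Submodule.subset_span ⟨i, hi, rfl⟩)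
  · refine Submodule.span_le.2 ?_
    rintro _ ⟨j, hj, rfl⟩
    refine (mem_dualCode_code_iff B A _).2 fun i hi => ?_
    have hij : i ≠ j := fun e => hj (e ▸ hi)
    exact (congrFun (congrFun h i) j).trans (Matrix.one_apply_ne hij)

/-- let `P` be an `N×N` upper triangular matrix over `𝔽₂` with unit diagonal
and `A ⊆ {0,…,N−1}`.  Then `C_{P·G_N}(A)^⊥ = C_{(Pᵗ)⁻¹·Q_π·G_N·Q_π}(Aᶜ)`. -/
theorem stmt10 (m : ℕ) (hm : 0 < m)
    (P : Matrix (Fin (2^m)) (Fin (2^m)) (ZMod 2))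
    (hupper : ∀ i j : Fin (2^m), j < i → P i j = 0)
    (hdiag : ∀ i : Fin (2^m), P i i = 1)
    (A : Set (Fin (2^m))) :
    dualCode (code (P * GN m) A) = code ((Pᵀ)⁻¹ * Qpi m * GN m * Qpi m) Aᶜ := by
  have hdet : P.det = 1 := by
    rw [Matrix.det_of_isUpperTriangular fun i j hij => hupper i j hij]
    simp [hdiag]
  have hP : IsUnit P.det := hdet ▸ isUnit_one
  refine dualCode_code_of_mul_transpose_eq_one ?_ A
  rw [Matrix.mul_assoc _ (Qpi m), Matrix.mul_assoc _ (Qpi m * GN m), Qpi_mul_GN_mul_Qpi,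
    Matrix.transpose_mul, Matrix.transpose_transpose, Matrix.transpose_nonsing_inv,
    Matrix.transpose_transpose, Matrix.mul_assoc, ← Matrix.mul_assoc (GN m), GN_mul_self,
    Matrix.one_mul, Matrix.mul_nonsing_inv P hP]
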